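/- The kernel of the projection Å on H^{2p+2+s}_ℓ(ℝ^{2p+1}) equals the range of the homological operator L_{B,ν}: one has ker Å = { L_{B,ν}g : g ∈ H^{2p+2+s}_ℓ(ℝ^{2p+1}) }. -/

import Mathlib

noncomputable section

open MeasureTheory Complex

abbrev V (p : ℕ) := ℝ × (Fin p → ℂ)
abbrev W (p s : ℕ) := V p × ℝ × (Fin s → ℝ)

/-- The torus action on `ℝ × ℂ^p`. -/
def torusAct (p : ℕ) (θ : Fin p → ℝ) (x : V p) : V p :=
  (x.1, fun j => Complex.exp (Complex.I * θ j) * x.2 j)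

/-- Variable index type for real coordinates on `W p s`. -/
abbrev HVar (p s : ℕ) := (Unit ⊕ Fin p × Bool) ⊕ Unit ⊕ Fin s

/-- Real coordinates of a point of `W p s`. -/
def coordsW {p s : ℕ} (w : W p s) : HVar p s → ℝ
  | .inl (.inl _) => w.1.1
  | .inl (.inr (j, b)) => if b then (w.1.2 j).re else (w.1.2 j).im
  | .inr (.inl _) => w.2.1
  | .inr (.inr k) => w.2.2 k

/-- `f` is a real-valued homogeneous polynomial of degree `ℓ` in coords of `W p s`. -/
def IsHomogScalar (p s ℓ : ℕ) (f : W p s → ℝ) : Prop :=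
  ∃ P : MvPolynomial (HVar p s) ℝ, P.IsHomogeneous ℓ ∧
    ∀ w, f w = MvPolynomial.eval (coordsW w) P

/-- Membership in `H^{2p+2+s}_ℓ(ℝ^{2p+1})`. -/
def MemH (p s ℓ : ℕ) (f : W p s → V p) : Prop :=
  IsHomogScalar p s ℓ (fun w => (f w).1) ∧
  ∀ j, IsHomogScalar p s ℓ (fun w => ((f w).2 j).re) ∧
       IsHomogScalar p s ℓ (fun w => ((f w).2 j).im)

/-- ν-independence. -/
def NuIndep (p s : ℕ) (f : W p s → V p) : Prop :=
  ∀ x ν ν' μ, f (x, ν, μ) = f (x, ν', μ)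

/-- Torus-equivariance. -/
def Equivar (p s : ℕ) (f : W p s → V p) : Prop :=
  ∀ θ x ν μ, f (torusAct p θ x, ν, μ) = torusAct p θ (f (x, ν, μ))

/-- The linear part `B(x) = (0, iω_1 x_1, …, iω_p x_p)`. -/
def Bmap (p : ℕ) (ω : Fin p → ℝ) (x : V p) : V p :=
  (0, fun j => Complex.I * (ω j : ℂ) * x.2 j)

/-- The homological operator `L_{B,ν}`. -/
def Lop (p s : ℕ) (ω : Fin p → ℝ) (f : W p s → V p) : W p s → V p :=
  fun w => fderiv ℝ f w (Bmap p ω w.1, 0, 0) - Bmap p ω (f w)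
    + w.2.1 • fderiv ℝ f w (((1 : ℝ), (0 : Fin p → ℂ)), 0, 0)

/-- Fundamental domain for the torus. -/
def torusBox (p : ℕ) : Set (Fin p → ℝ) := Set.univ.pi fun _ => Set.Icc 0 (2 * Real.pi)

/-- The averaging operator `Å`. -/
def Aop (p s : ℕ) (f : W p s → V p) : W p s → V p :=
  fun w => ((2 * Real.pi) ^ p)⁻¹ •
    ∫ θ in torusBox p, torusAct p θ (f (torusAct p (-θ) w.1, 0, w.2.2))

-- radial side
abbrev VZ (p : ℕ) := ℝ × (Fin p → ℝ)
abbrev WZ (p s : ℕ) := VZ p × (Fin s → ℝ)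

abbrev ZVar (p s : ℕ) := (Unit ⊕ Fin p) ⊕ Fin s

def coordsZ {p s : ℕ} (w : WZ p s) : ZVar p s → ℝ
  | .inl (.inl _) => w.1.1
  | .inl (.inr j) => w.1.2 j
  | .inr k => w.2 k

def IsHomogScalarZ (p s ℓ : ℕ) (f : WZ p s → ℝ) : Prop :=
  ∃ P : MvPolynomial (ZVar p s) ℝ, P.IsHomogeneous ℓ ∧
    ∀ w, f w = MvPolynomial.eval (coordsZ w) P

/-- Membership in `H^{p+1+s}_ℓ(ℝ^{p+1}, Z_{2,p})`. -/
def MemZ (p s ℓ : ℕ) (g : WZ p s → VZ p) : Prop :=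
  (IsHomogScalarZ p s ℓ fun w => (g w).1) ∧
  (∀ j, IsHomogScalarZ p s ℓ fun w => (g w).2 j) ∧
  (∀ lam : Fin p → ℝ, (∀ j, lam j = 1 ∨ lam j = -1) →
    ∀ ρ μ, g ((ρ.1, fun j => lam j * ρ.2 j), μ)
      = ((g (ρ, μ)).1, fun j => lam j * (g (ρ, μ)).2 j))

/-- Inclusion of real radial coordinates into `ℝ × ℂ^p`. -/
def embZ (p : ℕ) (ρ : VZ p) : V p := (ρ.1, fun j => (ρ.2 j : ℂ))

/-- The operator Π extracting the radial part. -/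
def Piop (p s : ℕ) (f : W p s → V p) : WZ p s → VZ p :=
  fun w => ((f (embZ p w.1, 0, w.2)).1, fun j => ((f (embZ p w.1, 0, w.2)).2 j).re)

def MuIndep (p s : ℕ) (f : W p s → V p) : Prop :=
  ∀ x ν μ μ', f (x, ν, μ) = f (x, ν, μ')

def VanishMu (p s : ℕ) (f : W p s → V p) : Prop :=
  ∀ x ν, f (x, ν, 0) = 0

def MuIndepZ (p s : ℕ) (g : WZ p s → VZ p) : Prop :=
  ∀ ρ μ μ', g (ρ, μ) = g (ρ, μ')

def VanishMuZ (p s : ℕ) (g : WZ p s → VZ p) : Prop :=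
  ∀ ρ, g (ρ, 0) = 0

end

noncomputable section

open Complex MeasureTheory
open scoped ComplexConjugate

section Scalar

variable {p s : ℕ}

lemma IsHomogScalar.add {n : ℕ} {f g : W p s → ℝ} (hf : IsHomogScalar p s n f)
    (hg : IsHomogScalar p s n g) : IsHomogScalar p s n (fun w => f w + g w) := by
  obtain ⟨P, hP, hf⟩ := hf
  obtain ⟨Q, hQ, hg⟩ := hg
  exact ⟨P + Q, hP.add hQ, fun w => by simp [hf, hg]⟩

lemma IsHomogScalar.const_mul {n : ℕ} {f : W p s → ℝ} (c : ℝ) (hf : IsHomogScalar p s n f) :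
    IsHomogScalar p s n (fun w => c * f w) := by
  obtain ⟨P, hP, hf⟩ := hf
  exact ⟨MvPolynomial.C c * P, by simpa using (MvPolynomial.isHomogeneous_C _ c).mul hP,
    fun w => by simp [hf]⟩

lemma IsHomogScalar.sub {n : ℕ} {f g : W p s → ℝ} (hf : IsHomogScalar p s n f)
    (hg : IsHomogScalar p s n g) : IsHomogScalar p s n (fun w => f w - g w) := by
  simpa [sub_eq_add_neg] using hf.add (hg.const_mul (-1))

lemma IsHomogScalar.mul {m n : ℕ} {f g : W p s → ℝ} (hf : IsHomogScalar p s m f)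
    (hg : IsHomogScalar p s n g) : IsHomogScalar p s (m + n) (fun w => f w * g w) := by
  obtain ⟨P, hP, hf⟩ := hf
  obtain ⟨Q, hQ, hg⟩ := hg
  exact ⟨P * Q, hP.mul hQ, fun w => by simp [hf, hg]⟩

lemma isHomogScalar_zero (n : ℕ) : IsHomogScalar p s n (fun _ => 0) :=
  ⟨0, MvPolynomial.isHomogeneous_zero _ _ _, fun w => by simp⟩

lemma isHomogScalar_one : IsHomogScalar p s 0 (fun _ => 1) :=
  ⟨1, MvPolynomial.isHomogeneous_one _ _, fun w => by simp⟩

lemma isHomogScalar_coordsW (v : HVar p s) : IsHomogScalar p s 1 (fun w => coordsW w v) :=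
  ⟨MvPolynomial.X v, MvPolynomial.isHomogeneous_X _ _, fun w => by simp⟩

end Scalar

/-- Complex-valued functions whose real and imaginary parts are homogeneous polynomials. -/
def complexHomog (p s n : ℕ) : Submodule ℂ (W p s → ℂ) where
  carrier := {F | IsHomogScalar p s n (fun w => (F w).re) ∧
    IsHomogScalar p s n (fun w => (F w).im)}
  add_mem' hF hG := ⟨by simpa using hF.1.add hG.1, by simpa using hF.2.add hG.2⟩
  zero_mem' := ⟨by simpa using isHomogScalar_zero n, by simpa using isHomogScalar_zero n⟩
  smul_mem' c F hF := ⟨by simpa using (hF.1.const_mul c.re).sub (hF.2.const_mul c.im),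
    by simpa using (hF.2.const_mul c.re).add (hF.1.const_mul c.im)⟩

instance (p s : ℕ) : SetLike.GradedMonoid (complexHomog p s) where
  one_mem := ⟨by simpa using isHomogScalar_one, by simpa using isHomogScalar_zero 0⟩
  mul_mem _ _ _ _ hF hG := ⟨by simpa using (hF.1.mul hG.1).sub (hF.2.mul hG.2),
    by simpa using (hF.1.mul hG.2).add (hF.2.mul hG.1)⟩

/-- The monomial `x₀ⁿ νᵏ z^a z̄^b μ^c`. -/
def zMonomial {p s : ℕ} (n k : ℕ) (a b : Fin p → ℕ) (c : Fin s → ℕ) (w : W p s) : ℂ :=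
  (w.1.1 : ℂ) ^ n * (w.2.1 : ℂ) ^ k *
    ((∏ j, w.1.2 j ^ a j) * ∏ j, conj (w.1.2 j) ^ b j) * ∏ j, (w.2.2 j : ℂ) ^ c j

/-- The span of the monomials of degree `ℓ` in `x₀, ν, z, z̄, μ`. -/
def zHomog (p s ℓ : ℕ) : Submodule ℂ (W p s → ℂ) :=
  Submodule.span ℂ {F | ∃ n k a b c, n + k + (∑ j, a j + ∑ j, b j) + ∑ j, c j = ℓ ∧
    F = zMonomial n k a b c}

section Homog

variable {p s : ℕ}

lemma zMonomial_mem (n k : ℕ) (a b : Fin p → ℕ) (c : Fin s → ℕ) {ℓ : ℕ}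
    (h : n + k + (∑ j, a j + ∑ j, b j) + ∑ j, c j = ℓ) :
    zMonomial n k a b c ∈ zHomog p s ℓ :=
  Submodule.subset_span ⟨n, k, a, b, c, h, rfl⟩

lemma zMonomial_mul (n k : ℕ) (a b : Fin p → ℕ) (c : Fin s → ℕ) (n' k' : ℕ)
    (a' b' : Fin p → ℕ) (c' : Fin s → ℕ) :
    (zMonomial n k a b c * zMonomial n' k' a' b' c' : W p s → ℂ) =
      zMonomial (n + n') (k + k') (a + a') (b + b') (c + c') := by
  ext w
  simp only [zMonomial, Pi.mul_apply, Pi.add_apply, pow_add, Finset.prod_mul_distrib]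
  ring

instance (p s : ℕ) : SetLike.GradedMonoid (zHomog p s) where
  one_mem := by
    convert zMonomial_mem 0 0 (0 : Fin p → ℕ) 0 (0 : Fin s → ℕ) (ℓ := 0) (by simp) using 1
    ext w
    simp [zMonomial]
  mul_mem i j F G hF hG := by
    refine (Submodule.mul_le (M := zHomog p s i) (N := zHomog p s j)).1 ?_ F hF G hG
    rw [zHomog, zHomog, Submodule.span_mul_span, Submodule.span_le]
    rintro _ ⟨_, ⟨n, k, a, b, c, h, rfl⟩, _, ⟨n', k', a', b', c', h', rfl⟩, rfl⟩
    refine Set.mem_of_eq_of_mem (zMonomial_mul n k a b c n' k' a' b' c') (zMonomial_mem _ _ _ _ _ ?_)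
    simp only [Pi.add_apply, Finset.sum_add_distrib]
    omega

lemma zMonomial_mem_complexHomog (n k : ℕ) (a b : Fin p → ℕ) (c : Fin s → ℕ) :
    zMonomial n k a b c ∈
      complexHomog p s (n + k + (∑ j, a j + ∑ j, b j) + ∑ j, c j) := by
  have hx : (fun w : W p s => (w.1.1 : ℂ)) ∈ complexHomog p s 1 :=
    ⟨by simpa [coordsW] using isHomogScalar_coordsW (.inl (.inl ())),
      by simpa using isHomogScalar_zero 1⟩
  have hν : (fun w : W p s => (w.2.1 : ℂ)) ∈ complexHomog p s 1 :=
    ⟨by simpa [coordsW] using isHomogScalar_coordsW (.inr (.inl ())),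
      by simpa using isHomogScalar_zero 1⟩
  have hμ (j) : (fun w : W p s => (w.2.2 j : ℂ)) ∈ complexHomog p s 1 :=
    ⟨by simpa [coordsW] using isHomogScalar_coordsW (.inr (.inr j)),
      by simpa using isHomogScalar_zero 1⟩
  have hz (j) : (fun w : W p s => w.1.2 j) ∈ complexHomog p s 1 :=
    ⟨by simpa [coordsW] using isHomogScalar_coordsW (.inl (.inr (j, true))),
      by simpa [coordsW] using isHomogScalar_coordsW (.inl (.inr (j, false)))⟩
  have hz' (j) : (fun w : W p s => conj (w.1.2 j)) ∈ complexHomog p s 1 :=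
    ⟨by simpa using (hz j).1, by simpa using (hz j).2.const_mul (-1)⟩
  have key := SetLike.mul_mem_graded (SetLike.mul_mem_graded (SetLike.mul_mem_graded
    (SetLike.pow_mem_graded n hx) (SetLike.pow_mem_graded k hν))
    (SetLike.mul_mem_graded
      (SetLike.prod_pow_mem_graded _ (F := Finset.univ) _ _ a fun j _ => hz j)
      (SetLike.prod_pow_mem_graded _ (F := Finset.univ) _ _ b fun j _ => hz' j)))
    (SetLike.prod_pow_mem_graded _ (F := Finset.univ) _ _ c fun j _ => hμ j)
  convert key using 1
  · simp
  · ext w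
    simp [zMonomial]

lemma ofReal_coordsW_mem (v : HVar p s) :
    (fun w : W p s => (coordsW w v : ℂ)) ∈ zHomog p s 1 := by
  have hz (j : Fin p) : (fun w : W p s => w.1.2 j) ∈ zHomog p s 1 := by
    convert zMonomial_mem 0 0 (Pi.single j 1) 0 0 (ℓ := 1) (by simp) using 1
    ext w
    simp [zMonomial, Pi.single_apply, pow_ite]
  have hz' (j : Fin p) : (fun w : W p s => conj (w.1.2 j)) ∈ zHomog p s 1 := by
    convert zMonomial_mem 0 0 0 (Pi.single j 1) 0 (ℓ := 1) (by simp) using 1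
    ext w
    simp [zMonomial, Pi.single_apply, pow_ite]
  rcases v with (_ | ⟨j, _ | _⟩) | _ | j
  · convert zMonomial_mem 1 0 0 0 0 (ℓ := 1) (by simp) using 1
    ext w
    simp [zMonomial, coordsW]
  · convert (zHomog p s 1).smul_mem (2 * I)⁻¹ ((zHomog p s 1).sub_mem (hz j) (hz' j)) using 1
    ext w
    simp [coordsW, Complex.sub_conj]
    field_simp
    simp
  · convert (zHomog p s 1).smul_mem 2⁻¹ ((zHomog p s 1).add_mem (hz j) (hz' j)) using 1
    ext w
    simp [coordsW, Complex.add_conj]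
  · convert zMonomial_mem 0 1 0 0 0 (ℓ := 1) (by simp) using 1
    ext w
    simp [zMonomial, coordsW]
  · convert zMonomial_mem 0 0 0 0 (Pi.single j 1) (ℓ := 1) (by simp) using 1
    ext w
    simp [zMonomial, coordsW, Pi.single_apply, pow_ite]

lemma IsHomogScalar.ofReal_mem {n : ℕ} {f : W p s → ℝ} (hf : IsHomogScalar p s n f) :
    (fun w => (f w : ℂ)) ∈ zHomog p s n := by
  obtain ⟨P, hP, hf⟩ := hf
  have : (fun w => (f w : ℂ)) = ∑ d ∈ P.support, ((P.coeff d : ℝ) : ℂ) •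
      ∏ v, (fun w : W p s => (coordsW w v : ℂ)) ^ d v := by
    ext w
    simp only [hf, MvPolynomial.eval_eq']
    simp [-Fintype.prod_sum_type]
  rw [this]
  refine Submodule.sum_mem _ fun d hd => Submodule.smul_mem _ _ ?_
  have key := SetLike.prod_pow_mem_graded (zHomog p s) (F := Finset.univ) _ _ d fun v _ =>
    ofReal_coordsW_mem v
  convert key using 1
  rw [← hP (MvPolynomial.mem_support_iff.1 hd)]
  simp [Finsupp.weight_apply, Finsupp.sum_fintype]

lemma mem_zHomog_iff {n : ℕ} {F : W p s → ℂ} :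
    F ∈ zHomog p s n ↔ IsHomogScalar p s n (fun w => (F w).re) ∧
      IsHomogScalar p s n (fun w => (F w).im) := by
  constructor
  · intro h
    suffices zHomog p s n ≤ complexHomog p s n from this h
    refine Submodule.span_le.2 ?_
    rintro _ ⟨n, k, a, b, c, rfl, rfl⟩
    exact zMonomial_mem_complexHomog n k a b c
  · rintro ⟨h₁, h₂⟩
    convert (zHomog p s n).add_mem h₁.ofReal_mem ((zHomog p s n).smul_mem I h₂.ofReal_mem) using 1
    ext w
    simpa [mul_comm] using (Complex.re_add_im (F w)).symm

lemma ofReal_mem_zHomog_iff {n : ℕ} {f : W p s → ℝ} :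
    (fun w => (f w : ℂ)) ∈ zHomog p s n ↔ IsHomogScalar p s n f := by
  simp [mem_zHomog_iff, isHomogScalar_zero]

lemma memH_iff {n : ℕ} {f : W p s → V p} :
    MemH p s n f ↔ (fun w => ((f w).1 : ℂ)) ∈ zHomog p s n ∧
      ∀ j, (fun w => (f w).2 j) ∈ zHomog p s n := by
  simp only [MemH, ofReal_mem_zHomog_iff, ← mem_zHomog_iff]

lemma differentiable_zMonomial (n k : ℕ) (a b : Fin p → ℕ) (c : Fin s → ℕ) :
    Differentiable ℝ (zMonomial n k a b c : W p s → ℂ) := by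
  have h : Differentiable ℝ (fun z : ℂ => conj z) := Complex.conjCLE.differentiable
  have h' : Differentiable ℝ (fun x : ℝ => (x : ℂ)) := Complex.ofRealCLM.differentiable
  unfold zMonomial
  fun_prop

lemma differentiable_of_mem_zHomog {n : ℕ} {F : W p s → ℂ} (hF : F ∈ zHomog p s n) :
    Differentiable ℝ F := by
  induction hF using Submodule.span_induction with
  | mem F hF =>
    obtain ⟨n, k, a, b, c, -, rfl⟩ := hF
    exact differentiable_zMonomial n k a b c
  | zero => exact differentiable_const _
  | add F G _ _ hF hG => exact hF.add hG
  | smul c F _ hF => exact hF.const_smul c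

lemma MemH.differentiable {n : ℕ} {f : W p s → V p} (hf : MemH p s n f) :
    Differentiable ℝ f := by
  rw [memH_iff] at hf
  have h₁ : Differentiable ℝ (fun w => (f w).1) :=
    Complex.reCLM.differentiable.comp (differentiable_of_mem_zHomog hf.1)
  exact h₁.prodMk (differentiable_pi.2 fun j => differentiable_of_mem_zHomog (hf.2 j))

end Homog

/-- The scalar homological operator of weight `m`. -/
def scalarLop {p s : ℕ} (ω : Fin p → ℝ) (m : Fin p → ℤ) (F : W p s → ℂ) (w : W p s) : ℂ :=
  fderiv ℝ F w (Bmap p ω w.1, 0, 0) - I * (∑ j, (m j : ℂ) * ω j) * F w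
    + w.2.1 * fderiv ℝ F w (((1 : ℝ), (0 : Fin p → ℂ)), 0, 0)

/-- The scalar torus average of weight `m`. -/
def scalarAop {p s : ℕ} (m : Fin p → ℤ) (F : W p s → ℂ) (w : W p s) : ℂ :=
  (((2 * Real.pi) ^ p)⁻¹ : ℝ) *
    ∫ θ in torusBox p, exp (I * ∑ j, (m j : ℂ) * θ j) * F (torusAct p (-θ) w.1, 0, w.2.2)

section Operators

variable {p s : ℕ}

lemma scalarLop_add (ω : Fin p → ℝ) (m : Fin p → ℤ) {F G : W p s → ℂ}
    (hF : Differentiable ℝ F) (hG : Differentiable ℝ G) :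
    scalarLop ω m (F + G) = scalarLop ω m F + scalarLop ω m G := by
  ext w
  simp only [scalarLop, Pi.add_apply, fderiv_add (hF w) (hG w), add_apply]
  ring

lemma scalarLop_smul (ω : Fin p → ℝ) (m : Fin p → ℤ) (c : ℂ) {F : W p s → ℂ}
    (hF : Differentiable ℝ F) : scalarLop ω m (c • F) = c • scalarLop ω m F := by
  ext w
  simp only [scalarLop, Pi.smul_apply, fderiv_const_smul (hF w), smul_apply,
    smul_eq_mul]
  ring

lemma continuous_torusAct : Continuous fun q : (Fin p → ℝ) × V p => torusAct p q.1 q.2 := by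
  unfold torusAct
  fun_prop

lemma isCompact_torusBox : IsCompact (torusBox p) :=
  isCompact_univ_pi fun _ => isCompact_Icc

lemma continuous_scalarAop_integrand (m : Fin p → ℤ) {F : W p s → ℂ} (hF : Continuous F)
    (w : W p s) : Continuous fun θ : Fin p → ℝ =>
      exp (I * ∑ j, (m j : ℂ) * θ j) * F (torusAct p (-θ) w.1, 0, w.2.2) := by
  have := (continuous_torusAct (p := p)).comp
    (continuous_neg.prodMk (continuous_const (y := w.1)))
  have h : Continuous fun θ : Fin p → ℝ => F (torusAct p (-θ) w.1, 0, w.2.2) :=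
    hF.comp (this.prodMk continuous_const)
  fun_prop

lemma scalarAop_add (m : Fin p → ℤ) {F G : W p s → ℂ} (hF : Continuous F)
    (hG : Continuous G) : scalarAop m (F + G) = scalarAop m F + scalarAop m G := by
  ext w
  simp only [scalarAop, Pi.add_apply, mul_add]
  rw [integral_add, mul_add]
  · exact (continuous_scalarAop_integrand m hF w).continuousOn.integrableOn_compact
      isCompact_torusBox
  · exact (continuous_scalarAop_integrand m hG w).continuousOn.integrableOn_compact
      isCompact_torusBox

lemma scalarAop_smul (m : Fin p → ℤ) (c : ℂ) (F : W p s → ℂ) :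
    scalarAop m (c • F) = c • scalarAop m F := by
  ext w
  simp only [scalarAop, Pi.smul_apply, smul_eq_mul, mul_left_comm _ c]
  rw [integral_const_mul, mul_left_comm]

lemma zMonomial_torusAct (n k : ℕ) (a b : Fin p → ℕ) (c : Fin s → ℕ) (θ : Fin p → ℝ)
    (x : V p) (y : ℝ × (Fin s → ℝ)) :
    zMonomial n k a b c (torusAct p θ x, y) =
      exp (I * ∑ j, ((a j : ℂ) - b j) * θ j) * zMonomial n k a b c (x, y) := by
  have h : exp (I * ∑ j, ((a j : ℂ) - b j) * θ j) =
      (∏ j, exp (I * θ j) ^ a j) * ∏ j, conj (exp (I * θ j)) ^ b j := by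
    simp only [← exp_conj, ← exp_nat_mul, ← exp_sum, ← exp_add, Finset.mul_sum,
      ← Finset.sum_add_distrib, map_mul, conj_I, conj_ofReal]
    congr 1
    exact Finset.sum_congr rfl fun j _ => by ring
  simp only [h, zMonomial, torusAct, map_mul, mul_pow, Finset.prod_mul_distrib]
  ring

lemma hasDerivAt_torusAct (ω : Fin p → ℝ) (x : V p) :
    HasDerivAt (fun t : ℝ => torusAct p (t • ω) x) (Bmap p ω x) 0 := by
  refine (hasDerivAt_const _ _).prodMk (hasDerivAt_pi.2 fun j => ?_)
  have h : HasDerivAt (fun t : ℝ => I * ((t * ω j : ℝ) : ℂ)) (I * ω j) 0 := by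
    simpa using (((hasDerivAt_id (0 : ℝ)).mul_const (ω j)).ofReal_comp).const_mul I
  simpa using (h.cexp.mul_const (x.2 j))

lemma torusAct_zero (x : V p) : torusAct p 0 x = x := by
  simp [torusAct]

lemma fderiv_zMonomial_Bmap (ω : Fin p → ℝ) (n k : ℕ) (a b : Fin p → ℕ) (c : Fin s → ℕ)
    (w : W p s) :
    fderiv ℝ (zMonomial n k a b c) w (Bmap p ω w.1, 0, 0) =
      I * (∑ j, ((a j : ℂ) - b j) * ω j) * zMonomial n k a b c w := by
  have hγ : HasDerivAt (fun t : ℝ => ((torusAct p (t • ω) w.1, w.2) : W p s))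
      (Bmap p ω w.1, 0, 0) 0 :=
    (hasDerivAt_torusAct ω w.1).prodMk (hasDerivAt_const _ _)
  have hF : HasFDerivAt (zMonomial n k a b c) (fderiv ℝ (zMonomial n k a b c) w)
      ((torusAct p ((0 : ℝ) • ω) w.1, w.2) : W p s) := by
    rw [zero_smul, torusAct_zero]
    exact (differentiable_zMonomial n k a b c w).hasFDerivAt
  have h₁ := hF.comp_hasDerivAt (0 : ℝ) hγ
  have h₂ : HasDerivAt (fun t : ℝ => exp (I * ∑ j, ((a j : ℂ) - b j) * ((t • ω) j : ℝ)) *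
      zMonomial n k a b c w) (I * (∑ j, ((a j : ℂ) - b j) * ω j) * zMonomial n k a b c w) 0 := by
    have h : HasDerivAt (fun t : ℝ => I * ∑ j, ((a j : ℂ) - b j) * ((t • ω) j : ℝ))
        (I * ∑ j, ((a j : ℂ) - b j) * ω j) 0 := by
      refine HasDerivAt.const_mul I (HasDerivAt.fun_sum fun j _ => HasDerivAt.const_mul _ ?_)
      simpa using ((hasDerivAt_id (0 : ℝ)).mul_const (ω j)).ofReal_comp
    simpa using h.cexp.mul_const (zMonomial n k a b c w)
  refine h₁.unique (h₂.congr_of_eventuallyEq (Filter.Eventually.of_forall fun t => ?_))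
  exact zMonomial_torusAct n k a b c (t • ω) w.1 w.2

lemma ofReal_mul_fderiv_zMonomial (n k : ℕ) (a b : Fin p → ℕ) (c : Fin s → ℕ) (w : W p s) :
    w.2.1 * fderiv ℝ (zMonomial n k a b c) w (((1 : ℝ), (0 : Fin p → ℂ)), 0, 0) =
      n * zMonomial (n - 1) (k + 1) a b c w := by
  have hγ : HasDerivAt (fun t : ℝ => (((t, w.1.2), w.2) : W p s))
      (((1 : ℝ), (0 : Fin p → ℂ)), 0, 0) w.1.1 :=
    ((hasDerivAt_id _).prodMk (hasDerivAt_const _ _)).prodMk (hasDerivAt_const _ _)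
  have h₁ := HasFDerivAt.comp_hasDerivAt w.1.1
    (differentiable_zMonomial n k a b c (((w.1.1, w.1.2), w.2) : W p s)).hasFDerivAt hγ
  have h₂ := (((((hasDerivAt_id w.1.1).ofReal_comp).pow n).mul_const ((w.2.1 : ℂ) ^ k)).mul_const
    ((∏ j, w.1.2 j ^ a j) * ∏ j, conj (w.1.2 j) ^ b j)).mul_const (∏ j, (w.2.2 j : ℂ) ^ c j)
  have h := h₁.unique h₂
  simp only [Prod.mk.eta] at h
  rw [h]
  simp only [zMonomial, id, ofReal_one]
  ring

lemma scalarLop_zMonomial (ω : Fin p → ℝ) (m : Fin p → ℤ) (n k : ℕ) (a b : Fin p → ℕ)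
    (c : Fin s → ℕ) :
    (scalarLop ω m (zMonomial n k a b c) : W p s → ℂ) =
      (I * ∑ j, (((a j : ℤ) - b j - m j : ℤ) : ℂ) * ω j) • zMonomial n k a b c +
        (n : ℂ) • zMonomial (n - 1) (k + 1) a b c := by
  ext w
  simp only [scalarLop, fderiv_zMonomial_Bmap, ofReal_mul_fderiv_zMonomial, Pi.add_apply,
    Pi.smul_apply, smul_eq_mul]
  push_cast
  simp only [sub_mul, Finset.sum_sub_distrib]
  ring

lemma integral_exp_int_mul (q : ℤ) :
    ∫ t in Set.Icc 0 (2 * Real.pi), exp (I * (q * (t : ℂ))) =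
      if q = 0 then ((2 * Real.pi : ℝ) : ℂ) else 0 := by
  rw [integral_Icc_eq_integral_Ioc, ← intervalIntegral.integral_of_le (by positivity)]
  split_ifs with h
  · simp [h]
  · have hq : I * q ≠ 0 := mul_ne_zero I_ne_zero (by exact_mod_cast h)
    simp_rw [← mul_assoc]
    rw [integral_exp_mul_complex hq]
    have : exp (I * q * (2 * Real.pi : ℝ)) = 1 := by
      rw [exp_eq_one_iff]
      exact ⟨q, by push_cast; ring⟩
    rw [this]
    simp

lemma integral_torusBox_exp (q : Fin p → ℤ) :
    ∫ θ in torusBox p, exp (I * ∑ j, (q j : ℂ) * θ j) =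
      if q = 0 then (((2 * Real.pi) ^ p : ℝ) : ℂ) else 0 := by
  have h : (volume : Measure (Fin p → ℝ)).restrict (torusBox p) =
      Measure.pi fun _ => volume.restrict (Set.Icc 0 (2 * Real.pi)) := by
    rw [torusBox, volume_pi, Measure.restrict_pi_pi]
  simp only [h, Finset.mul_sum, exp_sum]
  rw [integral_fintype_prod_eq_prod (𝕜 := ℂ) (fun j (t : ℝ) => exp (I * (q j * (t : ℂ))))]
  simp only [integral_exp_int_mul]
  split_ifs with hq
  · simp [hq]
  · obtain ⟨j, hj⟩ := Function.ne_iff.1 hq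
    exact Finset.prod_eq_zero (Finset.mem_univ j) (if_neg hj)

lemma zMonomial_nu_zero (n k : ℕ) (a b : Fin p → ℕ) (c : Fin s → ℕ) (w : W p s) :
    zMonomial n k a b c (w.1, 0, w.2.2) = if k = 0 then zMonomial n k a b c w else 0 := by
  split_ifs with hk <;> simp [zMonomial, hk]

lemma scalarAop_zMonomial (m : Fin p → ℤ) (n k : ℕ) (a b : Fin p → ℕ) (c : Fin s → ℕ) :
    (scalarAop m (zMonomial n k a b c) : W p s → ℂ) =
      if k = 0 ∧ ∀ j, (a j : ℤ) - b j - m j = 0 then zMonomial n k a b c else 0 := by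
  ext w
  have h (θ : Fin p → ℝ) : exp (I * ∑ j, (m j : ℂ) * θ j) *
      zMonomial n k a b c (torusAct p (-θ) w.1, 0, w.2.2) =
      exp (I * ∑ j, ((m j - ((a j : ℤ) - b j) : ℤ) : ℂ) * θ j) *
        zMonomial n k a b c (w.1, 0, w.2.2) := by
    rw [zMonomial_torusAct, ← mul_assoc, ← exp_add, ← mul_add, ← Finset.sum_add_distrib]
    congr 3
    refine Finset.sum_congr rfl fun j _ => ?_
    simp only [Pi.neg_apply]
    push_cast
    ring
  have hiff : (fun j => m j - ((a j : ℤ) - b j)) = 0 ↔ ∀ j, (a j : ℤ) - b j - m j = 0 := by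
    simp only [funext_iff, Pi.zero_apply, sub_eq_zero, eq_comm]
  simp only [scalarAop, h]
  rw [integral_mul_const, integral_torusBox_exp (fun j => m j - ((a j : ℤ) - b j)),
    zMonomial_nu_zero]
  simp only [hiff]
  by_cases hk : k = 0 <;> by_cases hm : ∀ j, (a j : ℤ) - b j - m j = 0
  · rw [if_pos hm, if_pos hk, if_pos ⟨hk, hm⟩, ← mul_assoc, ← ofReal_mul,
      inv_mul_cancel₀ (by positivity)]
    simp
  · simp [hm]
  · simp [hk]
  · simp [hk]

lemma int_sum_eq_zero_iff {ω : Fin p → ℝ}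
    (hind : ∀ r : Fin p → ℚ, (∑ j, (r j : ℝ) * ω j) = 0 → ∀ j, r j = 0) (q : Fin p → ℤ) :
    (∑ j, (q j : ℂ) * ω j) = 0 ↔ ∀ j, q j = 0 := by
  refine ⟨fun h j => ?_, fun h => by simp [h]⟩
  have := hind (fun j => q j) (by simpa using (by exact_mod_cast h : ∑ j, (q j : ℝ) * ω j = 0)) j
  exact_mod_cast this

/-- The image of the homogeneous functions under the scalar homological operator. -/
def scalarLopRange (p s ℓ : ℕ) (ω : Fin p → ℝ) (m : Fin p → ℤ) : Submodule ℂ (W p s → ℂ) where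
  carrier := {F | ∃ G ∈ zHomog p s ℓ, F = scalarLop ω m G}
  add_mem' := by
    rintro _ _ ⟨F, hF, rfl⟩ ⟨G, hG, rfl⟩
    exact ⟨F + G, add_mem hF hG, (scalarLop_add ω m (differentiable_of_mem_zHomog hF)
      (differentiable_of_mem_zHomog hG)).symm⟩
  zero_mem' := ⟨0, zero_mem _, by
    simpa using (scalarLop_smul ω m 0 (differentiable_const (0 : ℂ) (E := W p s))).symm⟩
  smul_mem' := by
    rintro c _ ⟨F, hF, rfl⟩
    exact ⟨c • F, Submodule.smul_mem _ c hF,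
      (scalarLop_smul ω m c (differentiable_of_mem_zHomog hF)).symm⟩

lemma zMonomial_mem_scalarLopRange_of_nonresonant {ω : Fin p → ℝ} {m : Fin p → ℤ}
    {a b : Fin p → ℕ} (hq : (∑ j, (((a j : ℤ) - b j - m j : ℤ) : ℂ) * ω j) ≠ 0)
    (n k : ℕ) (c : Fin s → ℕ) :
    zMonomial n k a b c ∈
      scalarLopRange p s (n + k + (∑ j, a j + ∑ j, b j) + ∑ j, c j) ω m := by
  induction n generalizing k with
  | zero =>
    refine (Submodule.smul_mem_iff _ (mul_ne_zero I_ne_zero hq)).1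
      ⟨_, zMonomial_mem 0 k a b c rfl, ?_⟩
    simp [scalarLop_zMonomial]
  | succ n ih =>
    refine (Submodule.smul_mem_iff _ (mul_ne_zero I_ne_zero hq)).1 ?_
    have h₁ : scalarLop ω m (zMonomial (n + 1) k a b c) ∈
        scalarLopRange p s (n + 1 + k + (∑ j, a j + ∑ j, b j) + ∑ j, c j) ω m :=
      ⟨_, zMonomial_mem (n + 1) k a b c rfl, rfl⟩
    have h₂ := ih (k + 1)
    rw [show n + (k + 1) = n + 1 + k by ring] at h₂
    have h := sub_mem h₁ (Submodule.smul_mem _ ((n + 1 : ℕ) : ℂ) h₂)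
    rwa [scalarLop_zMonomial, Nat.add_sub_cancel, add_sub_cancel_right] at h

lemma zMonomial_mem_scalarLopRange_of_resonant (ω : Fin p → ℝ) {m : Fin p → ℤ}
    {a b : Fin p → ℕ} (hq : ∀ j, (a j : ℤ) - b j - m j = 0) (n k : ℕ) (c : Fin s → ℕ) :
    zMonomial n (k + 1) a b c ∈
      scalarLopRange p s (n + (k + 1) + (∑ j, a j + ∑ j, b j) + ∑ j, c j) ω m := by
  refine (Submodule.smul_mem_iff _ (Nat.cast_ne_zero (R := ℂ).2 n.succ_ne_zero)).1
    ⟨_, zMonomial_mem (n + 1) k a b c (by ring), ?_⟩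
  simp [scalarLop_zMonomial, hq]

lemma sub_scalarAop_mem_scalarLopRange {ω : Fin p → ℝ}
    (hind : ∀ r : Fin p → ℚ, (∑ j, (r j : ℝ) * ω j) = 0 → ∀ j, r j = 0) (m : Fin p → ℤ)
    {ℓ : ℕ} {F : W p s → ℂ} (hF : F ∈ zHomog p s ℓ) :
    F - scalarAop m F ∈ scalarLopRange p s ℓ ω m := by
  induction hF using Submodule.span_induction with
  | mem F hF =>
    obtain ⟨n, k, a, b, c, rfl, rfl⟩ := hF
    rw [scalarAop_zMonomial]
    by_cases hq : ∀ j, (a j : ℤ) - b j - m j = 0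
    · rcases k with _ | k
      · simp [hq]
      · simpa using zMonomial_mem_scalarLopRange_of_resonant ω hq n k c
    · rw [if_neg fun h => hq h.2, sub_zero]
      exact zMonomial_mem_scalarLopRange_of_nonresonant
        (mt (int_sum_eq_zero_iff hind fun j => (a j : ℤ) - b j - m j).1 hq) n k c
  | zero =>
    have : scalarAop m (0 : W p s → ℂ) = 0 := by simpa using scalarAop_smul m 0 (0 : W p s → ℂ)
    simp [this]
  | add F G hF hG ihF ihG =>
    rw [scalarAop_add m (differentiable_of_mem_zHomog hF).continuous
      (differentiable_of_mem_zHomog hG).continuous, add_sub_add_comm]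
    exact add_mem ihF ihG
  | smul c F hF ih =>
    rw [scalarAop_smul, ← smul_sub]
    exact Submodule.smul_mem _ c ih

lemma scalarLop_mem_and_scalarAop_scalarLop {ω : Fin p → ℝ}
    (hind : ∀ r : Fin p → ℚ, (∑ j, (r j : ℝ) * ω j) = 0 → ∀ j, r j = 0) (m : Fin p → ℤ)
    {ℓ : ℕ} {G : W p s → ℂ} (hG : G ∈ zHomog p s ℓ) :
    scalarLop ω m G ∈ zHomog p s ℓ ∧ scalarAop m (scalarLop ω m G) = 0 := by
  induction hG using Submodule.span_induction with
  | mem F hF =>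
    obtain ⟨n, k, a, b, c, rfl, rfl⟩ := hF
    rw [scalarLop_zMonomial]
    constructor
    · refine add_mem (Submodule.smul_mem _ _ (zMonomial_mem _ _ _ _ _ rfl)) ?_
      rcases n with _ | n
      · simp
      · exact Submodule.smul_mem _ _ (zMonomial_mem _ _ _ _ _ (by simp; ring))
    · rw [scalarAop_add, scalarAop_smul, scalarAop_smul, scalarAop_zMonomial,
        scalarAop_zMonomial]
      · by_cases hq : ∀ j, (a j : ℤ) - b j - m j = 0
        · rw [(int_sum_eq_zero_iff hind fun j => (a j : ℤ) - b j - m j).2 hq]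
          simp
        · simp [hq]
      all_goals exact ((differentiable_zMonomial _ _ _ _ _).continuous.const_smul _)
  | zero =>
    have h₁ : scalarLop ω m (0 : W p s → ℂ) = 0 := by
      simpa using scalarLop_smul ω m 0 (differentiable_const (0 : ℂ) (E := W p s))
    have h₂ : scalarAop m (0 : W p s → ℂ) = 0 := by simpa using scalarAop_smul m 0 (0 : W p s → ℂ)
    simp [h₁, h₂]
  | add F G hF hG ihF ihG =>
    rw [scalarLop_add ω m (differentiable_of_mem_zHomog hF) (differentiable_of_mem_zHomog hG)]
    refine ⟨add_mem ihF.1 ihG.1, ?_⟩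
    rw [scalarAop_add m (differentiable_of_mem_zHomog ihF.1).continuous
      (differentiable_of_mem_zHomog ihG.1).continuous, ihF.2, ihG.2, add_zero]
  | smul c F hF ih =>
    rw [scalarLop_smul ω m c (differentiable_of_mem_zHomog hF), scalarAop_smul, ih.2, smul_zero]
    exact ⟨Submodule.smul_mem _ c ih.1, rfl⟩

lemma ofReal_Lop_fst (ω : Fin p → ℝ) {g : W p s → V p} (hg : Differentiable ℝ g) :
    (fun w => ((Lop p s ω g w).1 : ℂ)) = scalarLop ω 0 fun w => ((g w).1 : ℂ) := by
  ext w
  have h : HasFDerivAt (fun w => ((g w).1 : ℂ))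
      (ofRealCLM.comp ((ContinuousLinearMap.fst ℝ ℝ (Fin p → ℂ)).comp (fderiv ℝ g w))) w :=
    ofRealCLM.hasFDerivAt.comp w (hg w).hasFDerivAt.fst
  simp [scalarLop, h.fderiv, Lop, Bmap]

lemma Lop_snd (ω : Fin p → ℝ) {g : W p s → V p} (hg : Differentiable ℝ g) (j : Fin p) :
    (fun w => (Lop p s ω g w).2 j) = scalarLop ω (Pi.single j 1) fun w => (g w).2 j := by
  ext w
  have h : HasFDerivAt (fun w => (g w).2 j)
      (((ContinuousLinearMap.proj j).comp (ContinuousLinearMap.snd ℝ ℝ (Fin p → ℂ))).comp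
        (fderiv ℝ g w)) w :=
    ((ContinuousLinearMap.proj j).comp
      (ContinuousLinearMap.snd ℝ ℝ (Fin p → ℂ))).hasFDerivAt.comp w (hg w).hasFDerivAt
  simp [scalarLop, h.fderiv, Lop, Bmap, Pi.single_apply]

lemma integrableOn_Aop_integrand {f : W p s → V p} (hf : Continuous f) (w : W p s) :
    IntegrableOn (fun θ => torusAct p θ (f (torusAct p (-θ) w.1, 0, w.2.2))) (torusBox p) := by
  have h₁ := (continuous_torusAct (p := p)).comp
    (continuous_neg.prodMk (continuous_const (y := w.1)))
  have h₂ : Continuous fun θ : Fin p → ℝ => f (torusAct p (-θ) w.1, 0, w.2.2) :=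
    hf.comp (h₁.prodMk continuous_const)
  exact (continuous_torusAct.comp (continuous_id.prodMk h₂)).continuousOn.integrableOn_compact
    isCompact_torusBox

lemma ofReal_Aop_fst {f : W p s → V p} (hf : Continuous f) :
    (fun w => ((Aop p s f w).1 : ℂ)) = scalarAop 0 fun w => ((f w).1 : ℂ) := by
  ext w
  simp only [Aop, scalarAop, Prod.smul_fst, smul_eq_mul, ofReal_mul,
    fst_integral (integrableOn_Aop_integrand hf w)]
  rw [← integral_complex_ofReal]
  simp [torusAct]

lemma Aop_snd {f : W p s → V p} (hf : Continuous f) (j : Fin p) :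
    (fun w => (Aop p s f w).2 j) = scalarAop (Pi.single j 1) fun w => (f w).2 j := by
  ext w
  have h := (integrableOn_Aop_integrand hf w)
  have h' := ((ContinuousLinearMap.proj (R := ℝ) (φ := fun _ : Fin p => ℂ) j).comp
    (ContinuousLinearMap.snd ℝ ℝ (Fin p → ℂ))).integral_comp_comm h
  simp only [ContinuousLinearMap.comp_apply, ContinuousLinearMap.proj_apply,
    ContinuousLinearMap.coe_snd'] at h'
  simp only [Aop, scalarAop, Prod.smul_snd, Pi.smul_apply, real_smul, ← h']
  simp [torusAct, Pi.single_apply]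

lemma ofReal_re_scalarLop (ω : Fin p → ℝ) {G : W p s → ℂ} (hG : Differentiable ℝ G) (w : W p s) :
    scalarLop ω 0 (fun w => ((G w).re : ℂ)) w = ((scalarLop ω 0 G w).re : ℂ) := by
  have h : HasFDerivAt (fun w => ((G w).re : ℂ))
      (ofRealCLM.comp (reCLM.comp (fderiv ℝ G w))) w :=
    ofRealCLM.hasFDerivAt.comp w (reCLM.hasFDerivAt.comp w (hG w).hasFDerivAt)
  simp [scalarLop, h.fderiv]

end Operators

/-- The kernel of the projection `Å` on `H^{2p+2+s}_ℓ(ℝ^{2p+1})`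
equals the range of the homological operator `L_{B,ν}`. -/
theorem ker_averaging_eq_range_homological
    (p s ℓ : ℕ) (hp : 1 ≤ p) (hℓ : 2 ≤ ℓ)
    (ω : Fin p → ℝ) (hω : ∀ j, 0 < ω j)
    (hind : ∀ r : Fin p → ℚ, (∑ j, (r j : ℝ) * ω j) = 0 → ∀ j, r j = 0) :
    {f : W p s → V p | MemH p s ℓ f ∧ Aop p s f = fun _ => 0} =
      {f : W p s → V p | ∃ g, MemH p s ℓ g ∧ f = Lop p s ω g} := by
  ext f
  constructor
  · rintro ⟨hf, hA⟩
    have hc := hf.differentiable.continuous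
    have hH := memH_iff.1 hf
    have hA₁ : scalarAop 0 (fun w => ((f w).1 : ℂ)) = 0 := by
      rw [← ofReal_Aop_fst hc, hA]
      rfl
    have hA₂ (j) : scalarAop (Pi.single j 1) (fun w => (f w).2 j) = 0 := by
      rw [← Aop_snd hc j, hA]
      rfl
    have h₁ := sub_scalarAop_mem_scalarLopRange hind 0 hH.1
    rw [hA₁, sub_zero] at h₁
    have h₂ (j) := sub_scalarAop_mem_scalarLopRange hind (Pi.single j 1) (hH.2 j)
    simp only [hA₂, sub_zero] at h₂
    obtain ⟨G₀, hG₀, h₁⟩ := h₁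
    choose G hG h₂ using h₂
    have hg : MemH p s ℓ fun w => ((G₀ w).re, fun j => G j w) :=
      memH_iff.2 ⟨(mem_zHomog_iff.1 hG₀).1.ofReal_mem, hG⟩
    refine ⟨_, hg, funext fun w => Prod.ext ?_ (funext fun j => ?_)⟩
    · have h := congrFun (ofReal_Lop_fst ω hg.differentiable) w
      rw [ofReal_re_scalarLop ω (differentiable_of_mem_zHomog hG₀), ← h₁] at h
      exact_mod_cast h.symm
    · exact (congrFun (h₂ j) w).trans (congrFun (Lop_snd ω hg.differentiable j) w).symm
  · rintro ⟨g, hg, rfl⟩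
    have hH := memH_iff.1 hg
    have h₁ := scalarLop_mem_and_scalarAop_scalarLop hind 0 hH.1
    have h₂ (j) := scalarLop_mem_and_scalarAop_scalarLop hind (Pi.single j 1) (hH.2 j)
    simp only [← ofReal_Lop_fst ω hg.differentiable] at h₁
    simp only [← Lop_snd ω hg.differentiable] at h₂
    have hL : MemH p s ℓ (Lop p s ω g) := memH_iff.2 ⟨h₁.1, fun j => (h₂ j).1⟩
    have hc := hL.differentiable.continuous
    refine ⟨hL, funext fun w => Prod.ext ?_ (funext fun j => ?_)⟩
    · have h := congrFun ((ofReal_Aop_fst hc).trans h₁.2) w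
      exact ofReal_eq_zero.1 h
    · exact congrFun ((Aop_snd hc j).trans (h₂ j).2) w

end
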